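/- arXiv:2503.09741 — 2 statements merged into one kernel-verified Lean document; each statement's English description precedes it below -/
import Mathlib

section
/- Suppose χ₁ and χ₂ are quadratic and q₁, q₂ > 4 are odd. Then for every γ ∈ Γ₀(q₁q₂), the number q₂·S_{χ₁,χ₂}(γ) is a rational integer. -/
open Complex Finset
open scoped Classical

/-- The sawtooth function `B₁(x)`: `0` if `x ∈ ℤ`, and `x - ⌊x⌋ - 1/2` otherwise. -/
noncomputable def sawtooth (x : ℝ) : ℝ :=
  if ∃ n : ℤ, (n : ℝ) = x then 0 else Int.fract x - 1 / 2

/-- The newform Dedekind sum `S_{χ₁,χ₂}(a, c)` associated to Dirichlet characters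
`χ₁ mod q₁` and `χ₂ mod q₂`. -/
noncomputable def newformDedekindSum {q₁ q₂ : ℕ} (χ₁ : DirichletCharacter ℂ q₁)
    (χ₂ : DirichletCharacter ℂ q₂) (a c : ℤ) : ℂ :=
  ∑ j ∈ Finset.range c.toNat, ∑ n ∈ Finset.range q₁,
    (starRingEnd ℂ) (χ₂ (j : ZMod q₂)) * (starRingEnd ℂ) (χ₁ (n : ZMod q₁)) *
      (sawtooth ((j : ℝ) / (c : ℝ)) : ℂ) *
      (sawtooth ((n : ℝ) / (q₁ : ℝ) + (a : ℝ) * (j : ℝ) / (c : ℝ)) : ℂ)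

/-- The newform Dedekind sum of a matrix `γ = (a, b; c, d) ∈ SL₂(ℤ)`:
it is `S_{χ₁,χ₂}(a, c)` if `c ≥ 1`, `S_{χ₁,χ₂}(-γ)` if `c ≤ -1`, and `0` if `c = 0`. -/
noncomputable def newformDedekindSumSL {q₁ q₂ : ℕ} (χ₁ : DirichletCharacter ℂ q₁)
    (χ₂ : DirichletCharacter ℂ q₂) (γ : Matrix.SpecialLinearGroup (Fin 2) ℤ) : ℂ :=
  if γ.1 1 0 = 0 then 0
  else if 1 ≤ γ.1 1 0 then newformDedekindSum χ₁ χ₂ (γ.1 0 0) (γ.1 1 0)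
  else newformDedekindSum χ₁ χ₂ (-(γ.1 0 0)) (-(γ.1 1 0))

/-- Membership in `Γ₀(N)`: the lower-left entry is divisible by `N`. -/
def InGamma0 (N : ℕ) (γ : Matrix.SpecialLinearGroup (Fin 2) ℤ) : Prop :=
  (N : ℤ) ∣ γ.1 1 0

/-- Membership in `Γ₁(N)`: lower-left entry divisible by `N` and both diagonal
entries congruent to `1` mod `N`. -/
def InGamma1 (N : ℕ) (γ : Matrix.SpecialLinearGroup (Fin 2) ℤ) : Prop :=
  InGamma0 N γ ∧ (N : ℤ) ∣ (γ.1 0 0 - 1) ∧ (N : ℤ) ∣ (γ.1 1 1 - 1)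

/-- `x` lies in the ring of integers `ℤ[χ₁,χ₂]` of the field `F_{χ₁,χ₂} ⊆ ℂ` generated
by the values of `χ₁` and `χ₂`: `x` lies in the subfield of `ℂ` generated by the values
of the characters and is integral over `ℤ`. -/
def InRingOfIntegers {q₁ q₂ : ℕ} (χ₁ : DirichletCharacter ℂ q₁)
    (χ₂ : DirichletCharacter ℂ q₂) (x : ℂ) : Prop :=
  x ∈ Subfield.closure (Set.range (χ₁ : ZMod q₁ → ℂ) ∪ Set.range (χ₂ : ZMod q₂ → ℂ)) ∧
    IsIntegral ℤ x

theorem sum_range_eq_sum_zmod {M : Type*} [AddCommMonoid M] (q : ℕ) [NeZero q] (F : ℕ → M) :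
    ∑ n ∈ range q, F n = ∑ x : ZMod q, F x.val := by
  obtain _ | q := q
  · exact absurd rfl (NeZero.ne 0)
  · exact (Fin.sum_univ_eq_sum_range F (q + 1)).symm

theorem sum_range_mul_eq {M : Type*} [AddCommMonoid M] (D q : ℕ) (F : ℕ → M) :
    ∑ i ∈ range (q * D), F i = ∑ m ∈ range q, ∑ r ∈ range D, F (m * D + r) := by
  induction q with
  | zero => simp
  | succ q ih => rw [Nat.succ_mul, Finset.sum_range_add, ih, Finset.sum_range_succ]

theorem sawtooth_add_int (x : ℝ) (n : ℤ) : sawtooth (x + n) = sawtooth x := by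
  have h : (∃ m : ℤ, (m : ℝ) = x + n) ↔ ∃ m : ℤ, (m : ℝ) = x :=
    ⟨fun ⟨m, hm⟩ => ⟨m - n, by push_cast; linarith⟩, fun ⟨m, hm⟩ => ⟨m + n, by push_cast; linarith⟩⟩
  simp [sawtooth, h]

theorem sawtooth_of_mem_Ioo {x : ℝ} (h0 : 0 < x) (h1 : x < 1) : sawtooth x = x - 1 / 2 := by
  have h : ¬ ∃ m : ℤ, (m : ℝ) = x := by
    rintro ⟨m, rfl⟩
    have h0' : 0 < m := by exact_mod_cast h0
    have h1' : m < 1 := by exact_mod_cast h1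
    omega
  rw [sawtooth, if_neg h, Int.fract_eq_self.2 ⟨h0.le, h1⟩]

theorem sawtooth_neg (x : ℝ) : sawtooth (-x) = -sawtooth x := by
  by_cases h : ∃ n : ℤ, (n : ℝ) = x
  · have h' : ∃ n : ℤ, (n : ℝ) = -x := by
      obtain ⟨n, hn⟩ := h
      exact ⟨-n, by push_cast; rw [hn]⟩
    rw [sawtooth, sawtooth, if_pos h, if_pos h', neg_zero]
  · have h' : ¬ ∃ n : ℤ, (n : ℝ) = -x := fun ⟨n, hn⟩ => h ⟨-n, by push_cast; rw [hn, neg_neg]⟩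
    have hf : Int.fract x ≠ 0 := fun h0 => by
      obtain ⟨n, hn⟩ := Int.fract_eq_zero_iff.1 h0
      exact h ⟨n, hn⟩
    rw [sawtooth, sawtooth, if_neg h, if_neg h', Int.fract_neg hf]
    ring

/-- A complex quadratic character comes from an integer-valued one. -/
theorem exists_int_character {q : ℕ} (χ : DirichletCharacter ℂ q) (h : χ ^ 2 = 1) :
    ∃ e : DirichletCharacter ℤ q, (∀ x, (e x : ℂ) = χ x) ∧ ∀ x, IsUnit x → e x = 1 ∨ e x = -1 := by
  have hv : ∀ x, IsUnit x → χ x = 1 ∨ χ x = -1 := by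
    rintro _ ⟨u, rfl⟩
    have := congrArg (fun ψ : DirichletCharacter ℂ q => ψ u) h
    simp only [MulChar.pow_apply_coe, MulChar.one_apply_coe] at this
    exact by simpa using this
  have hz : ∀ x, ∃ z : ℤ, (z : ℂ) = χ x := by
    intro x
    by_cases hx : IsUnit x
    · rcases hv x hx with h1 | h1
      · exact ⟨1, by simp [h1]⟩
      · exact ⟨-1, by simp [h1]⟩
    · exact ⟨0, by simp [χ.map_nonunit hx]⟩
  choose e he using hz
  refine ⟨{ toFun := e, map_one' := ?_, map_mul' := ?_, map_nonunit' := ?_ }, he, ?_⟩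
  · exact_mod_cast (he 1).trans (map_one χ)
  · intro x y
    have : (e (x * y) : ℂ) = e x * e y := by rw [he, he, he, map_mul]
    exact_mod_cast this
  · intro x hx
    exact_mod_cast (he x).trans (χ.map_nonunit hx)
  · intro x hx
    refine (hv x hx).imp (fun h1 => ?_) fun h1 => ?_
    · exact_mod_cast (he x).trans h1
    · exact_mod_cast (he x).trans h1

/-- For a primitive quadratic character of odd modulus `q > 4`, `q` divides `∑ k, e k * k`. -/
theorem sum_character_mul_self_eq_zero {q : ℕ} [NeZero q] (χ : DirichletCharacter ℂ q)
    (hp : χ.IsPrimitive) (hodd : Odd q) (h4 : 4 < q) (e : DirichletCharacter ℤ q)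
    (he : ∀ x, (e x : ℂ) = χ x) (hu : ∀ x, IsUnit x → e x = 1 ∨ e x = -1) :
    ∑ k : ZMod q, (e k : ZMod q) * k = 0 := by
  set T := ∑ k : ZMod q, (e k : ZMod q) * k with hT
  have key : ∀ u : (ZMod q)ˣ, (e u : ZMod q) * u * T = T := by
    intro u
    rw [hT, Finset.mul_sum]
    refine Fintype.sum_equiv (Units.mulLeft u) _ _ fun k => ?_
    simp only [Units.mulLeft_apply, map_mul, Int.cast_mul]
    ring
  have two : IsUnit ((2 : ℕ) : ZMod q) :=
    (ZMod.isUnit_iff_coprime 2 q).2 (Nat.coprime_two_left.2 hodd)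
  have h2 := key two.unit
  simp only [IsUnit.unit_spec] at h2
  rcases hu _ two with h | h
  · rw [h] at h2
    push_cast at h2
    linear_combination h2
  rw [h] at h2
  push_cast at h2
  have h3 : (3 : ZMod q) * T = 0 := by linear_combination -h2
  by_cases hd : 3 ∣ q
  · by_contra hT0
    have hmod : ∀ u : (ZMod q)ˣ, e u * ((u : ZMod q).val : ℤ) % 3 = 1 := by
      intro u
      by_contra hne
      have hku := key u
      have hcast : (e u : ZMod q) * u = ((e u * ((u : ZMod q).val : ℤ) : ℤ) : ZMod q) := by
        simp
      rw [hcast] at hku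
      generalize e u * ((u : ZMod q).val : ℤ) = w at hku hne
      have hw := Int.emod_add_mul_ediv w 3
      rcases (by omega : w % 3 = 0 ∨ w % 3 = 2) with h0 | h0 <;> rw [h0] at hw <;>
        rw [← hw] at hku <;> push_cast at hku <;> apply hT0
      · linear_combination ((w / 3 : ℤ) : ZMod q) * h3 - hku
      · linear_combination hku - ((w / 3 : ℤ) : ZMod q) * h3
    have hf : χ.FactorsThrough 3 := by
      rw [DirichletCharacter.factorsThrough_iff_ker_unitsMap hd]
      intro u huk
      rw [MonoidHom.mem_ker] at huk ⊢
      have hval : ((u : ZMod q).val : ℤ) % 3 = 1 := by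
        have h1 := congrArg Units.val huk
        rw [ZMod.unitsMap_val, Units.val_one, ZMod.cast_eq_val] at h1
        have h1' : (((u : ZMod q).val : ℕ) : ZMod 3) = ((1 : ℕ) : ZMod 3) := by simpa using h1
        rw [ZMod.natCast_eq_natCast_iff'] at h1'
        omega
      have hm := hmod u
      have he1 : e u = 1 := by
        rcases hu u u.isUnit with h1 | h1
        · exact h1
        · rw [h1] at hm
          omega
      ext
      rw [MulChar.coe_toUnitHom, ← he, he1]
      simp
    have hle : χ.conductor ≤ 3 := Nat.sInf_le hf
    rw [hp] at hle
    omega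
  · have three : IsUnit ((3 : ℕ) : ZMod q) :=
      (ZMod.isUnit_iff_coprime 3 q).2 ((Nat.Prime.coprime_iff_not_dvd Nat.prime_three).2 hd)
    exact three.mul_right_eq_zero.1 (by exact_mod_cast h3)

theorem sawtooth_div_add_congr {q : ℕ} [NeZero q] {u v : ℤ} (h : (u : ZMod q) = v) (x : ℝ) :
    sawtooth ((u : ℝ) / q + x) = sawtooth ((v : ℝ) / q + x) := by
  rw [ZMod.intCast_eq_intCast_iff_dvd_sub] at h
  obtain ⟨w, hw⟩ := h
  have hq : (q : ℝ) ≠ 0 := NeZero.ne _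
  have hw' : (v : ℝ) - u = q * w := by exact_mod_cast hw
  rw [← sawtooth_add_int _ w]
  congr 1
  field_simp
  linarith

/-- The sawtooth function twisted by an integer-valued character. -/
noncomputable def twistedSawtooth {q : ℕ} [NeZero q] (e : DirichletCharacter ℤ q) (x : ℝ) : ℝ :=
  ∑ n : ZMod q, (e n : ℝ) * sawtooth ((n.val : ℝ) / q + x)

theorem twistedSawtooth_div_congr {q c : ℕ} [NeZero q] [NeZero c] (e : DirichletCharacter ℤ q)
    {u v : ℤ} (h : (u : ZMod c) = v) :
    twistedSawtooth e ((u : ℝ) / c) = twistedSawtooth e ((v : ℝ) / c) := by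
  refine Finset.sum_congr rfl fun n _ => ?_
  rw [add_comm, sawtooth_div_add_congr h, add_comm]

theorem twistedSawtooth_neg {q : ℕ} [NeZero q] (e : DirichletCharacter ℤ q) (x : ℝ) :
    twistedSawtooth e (-x) = -(e (-1)) * twistedSawtooth e x := by
  rw [twistedSawtooth, twistedSawtooth, Finset.mul_sum]
  refine Fintype.sum_equiv (Equiv.neg _) _ _ fun n => ?_
  have h1 : ((e (-1) : ℤ) : ℝ) * (e (-1) : ℤ) = 1 := by
    rw [← Int.cast_mul, ← map_mul]
    simp
  have h2 := sawtooth_div_add_congr (q := q) (u := ((-n).val : ℤ)) (v := -(n.val : ℤ))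
    (by simp) x
  push_cast at h2
  rw [Equiv.neg_apply, h2, neg_eq_neg_one_mul n, map_mul,
    show -(n.val : ℝ) / q + x = -((n.val : ℝ) / q + -x) by ring, sawtooth_neg]
  push_cast
  linear_combination -((e n : ℤ) : ℝ) * sawtooth ((n.val : ℝ) / q + -x) * h1

/-- A nontrivial twisted sawtooth function with `q ∣ ∑ k, e k * k` takes integer values of mean
zero on the open intervals between consecutive multiples of `1 / q`. -/
theorem exists_twistedSawtooth_eq {q : ℕ} [NeZero q] (e : DirichletCharacter ℤ q) (he : e ≠ 1)
    (hT : ∑ k : ZMod q, (e k : ZMod q) * k = 0) :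
    ∃ G : ZMod q → ℤ, ∑ m, G m = 0 ∧ ∀ (m : ℕ) (y : ℝ), 0 < y → y < 1 / q →
      twistedSawtooth e ((m : ℝ) / q + y) = G m := by
  have hq : (q : ℝ) ≠ 0 := NeZero.ne _
  have hq0 : (0 : ℝ) < q := by exact_mod_cast NeZero.pos q
  have hsum : ∑ k, e k = 0 := MulChar.sum_eq_zero_of_ne_one he
  have hshift : ∀ m : ZMod q, ∑ k, e (k - m) = 0 := fun m => by
    rw [← hsum]
    exact Fintype.sum_equiv (Equiv.subRight m) _ _ fun k => rfl
  have hdvd : ∀ m : ZMod q, ∃ g : ℤ, ∑ k, e (k - m) * (k.val : ℤ) = q * g := by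
    intro m
    rw [← dvd_def, ← ZMod.intCast_zmod_eq_zero_iff_dvd]
    push_cast
    simp only [ZMod.natCast_val, ZMod.cast_id', id_eq]
    have h1 : ∑ k : ZMod q, (e (k - m) : ZMod q) * (k - m) = 0 := by
      rw [← hT]
      exact Fintype.sum_equiv (Equiv.subRight m) _ _ fun k => rfl
    have h2 : ∑ k : ZMod q, (e (k - m) : ZMod q) = 0 := by
      exact_mod_cast congrArg (Int.cast : ℤ → ZMod q) (hshift m)
    simp only [mul_sub, Finset.sum_sub_distrib, ← Finset.sum_mul, h2, zero_mul, sub_zero] at h1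
    exact h1
  choose G hG using hdvd
  refine ⟨G, ?_, fun m y hy0 hy1 => ?_⟩
  · have h : (q : ℤ) * ∑ m, G m = 0 := by
      rw [Finset.mul_sum, ← Finset.sum_congr rfl fun m _ => hG m, Finset.sum_comm]
      refine Finset.sum_eq_zero fun k _ => ?_
      rw [← Finset.sum_mul, Fintype.sum_equiv (Equiv.subLeft k) (fun m => e (k - m)) e
        fun m => rfl, hsum, zero_mul]
    exact (mul_eq_zero.1 h).resolve_left (NeZero.ne _)
  · have h1 : twistedSawtooth e ((m : ℝ) / q + y) =
        ∑ k : ZMod q, (e (k - m) : ℝ) * sawtooth ((k.val : ℝ) / q + y) := by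
      refine Fintype.sum_equiv (Equiv.addRight (m : ZMod q)) _ _ fun n => ?_
      have h2 := sawtooth_div_add_congr (q := q) (u := (n.val : ℤ) + m)
        (v := ((n + (m : ZMod q)).val : ℤ)) (by simp) y
      push_cast at h2
      rw [Equiv.coe_addRight, add_sub_cancel_right, ← h2, add_div, add_assoc]
    have h2 : ∀ k : ZMod q, sawtooth ((k.val : ℝ) / q + y) = (k.val : ℝ) / q + y - 1 / 2 := by
      intro k
      refine sawtooth_of_mem_Ioo (by positivity) ?_
      have hk : (k.val : ℝ) + 1 ≤ q := by exact_mod_cast ZMod.val_lt k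
      calc (k.val : ℝ) / q + y < k.val / q + 1 / q := by linarith
        _ = (k.val + 1) / q := by ring
        _ ≤ 1 := (div_le_one hq0).2 hk
    have h3 : ∑ k : ZMod q, (e (k - m) : ℝ) = 0 := by exact_mod_cast hshift m
    have h4 : ∑ k : ZMod q, (e (k - m) : ℝ) * k.val = q * G m := by exact_mod_cast hG m
    rw [h1]
    calc ∑ k : ZMod q, (e (k - m) : ℝ) * sawtooth ((k.val : ℝ) / q + y)
        = ∑ k : ZMod q, ((e (k - m) : ℝ) * k.val / q + (e (k - m) : ℝ) * (y - 1 / 2)) :=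
          Finset.sum_congr rfl fun k _ => by rw [h2]; ring
      _ = G m := by
          rw [Finset.sum_add_distrib, ← Finset.sum_div, ← Finset.sum_mul, h3, h4]
          field_simp
          ring

theorem sum_range_mul_character {q : ℕ} [NeZero q] (e : DirichletCharacter ℤ q) (he : e ≠ 1)
    (k : ℕ) : ∑ r ∈ Finset.range (k * q), e (r : ZMod q) = 0 := by
  rw [sum_range_mul_eq]
  refine Finset.sum_eq_zero fun m _ => ?_
  rw [sum_range_eq_sum_zmod, ← MulChar.sum_eq_zero_of_ne_one he]
  refine Finset.sum_congr rfl fun x _ => ?_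
  simp

theorem sum_id_mul_eq_zero {q₁ q₂ k : ℕ} [NeZero q₁] [NeZero q₂] (hk : 0 < k)
    (e : DirichletCharacter ℤ q₂) (he : e ≠ 1) (G : ZMod q₁ → ℤ) (hG : ∑ m, G m = 0) :
    ∑ i ∈ Finset.range (q₁ * (k * q₂)),
      (i : ℤ) * (e (i : ZMod q₂) * G ((i / (k * q₂) : ℕ) : ZMod q₁)) = 0 := by
  have hD : 0 < k * q₂ := Nat.mul_pos hk (NeZero.pos q₂)
  have h1 : ∀ m ∈ Finset.range q₁, ∑ r ∈ Finset.range (k * q₂), ((m * (k * q₂) + r : ℕ) : ℤ) *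
      (e ((m * (k * q₂) + r : ℕ) : ZMod q₂) *
        G (((m * (k * q₂) + r) / (k * q₂) : ℕ) : ZMod q₁)) =
      G (m : ZMod q₁) * ∑ r ∈ Finset.range (k * q₂), (r : ℤ) * e (r : ZMod q₂) := by
    intro m _
    calc _ = ∑ r ∈ Finset.range (k * q₂), (G (m : ZMod q₁) * ((r : ℤ) * e (r : ZMod q₂)) +
          ((m * (k * q₂) : ℕ) : ℤ) * G (m : ZMod q₁) * e (r : ZMod q₂)) := by
          refine Finset.sum_congr rfl fun r hr => ?_
          rw [mul_comm m, Nat.mul_add_div hD, Nat.div_eq_of_lt (Finset.mem_range.1 hr), add_zero]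
          push_cast
          simp only [CharP.cast_eq_zero, mul_zero, zero_mul, zero_add]
          ring
      _ = _ := by
          rw [Finset.sum_add_distrib, ← Finset.mul_sum, ← Finset.mul_sum,
            sum_range_mul_character e he, mul_zero, add_zero]
  rw [sum_range_mul_eq, Finset.sum_congr rfl h1, ← Finset.sum_mul, sum_range_eq_sum_zmod]
  have : ∑ x : ZMod q₁, G ((x.val : ℕ) : ZMod q₁) = 0 := by
    rw [← hG]
    exact Finset.sum_congr rfl fun x _ => by simp
  rw [this, zero_mul]

theorem newformDedekindSum_eq_sum_twistedSawtooth {q₁ q₂ c : ℕ} [NeZero q₁] [NeZero c]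
    (χ₁ : DirichletCharacter ℂ q₁) (χ₂ : DirichletCharacter ℂ q₂)
    (e₁ : DirichletCharacter ℤ q₁) (e₂ : DirichletCharacter ℤ q₂)
    (h₁ : ∀ x, (e₁ x : ℂ) = χ₁ x) (h₂ : ∀ x, (e₂ x : ℂ) = χ₂ x) (a : ℤ) :
    newformDedekindSum χ₁ χ₂ a c =
      ((∑ j : ZMod c, sawtooth ((j.val : ℝ) / c) *
        (e₂ (j.val : ZMod q₂) * twistedSawtooth e₁ (((a * j.val : ℤ) : ℝ) / c)) : ℝ) : ℂ) := by
  rw [newformDedekindSum, Int.toNat_natCast, sum_range_eq_sum_zmod, Complex.ofReal_sum]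
  refine Finset.sum_congr rfl fun j _ => ?_
  rw [sum_range_eq_sum_zmod, twistedSawtooth, Finset.mul_sum, Finset.mul_sum, Complex.ofReal_sum]
  refine Finset.sum_congr rfl fun n _ => ?_
  rw [← h₁, ← h₂, map_intCast, map_intCast, ZMod.natCast_zmod_val]
  simp only [Complex.ofReal_mul, Complex.ofReal_intCast, Int.cast_mul, Int.cast_natCast]
  ring

/-- An odd integer-valued function `h` on `ℤ/c` with `c ∣ ∑ i, i * h i` pairs integrally with the
sawtooth function, also after rescaling by a unit. -/
theorem exists_int_eq_sum_sawtooth_mul {c : ℕ} [NeZero c] (h : ZMod c → ℤ)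
    (h0 : h 0 = 0) (hodd : ∀ i, h (-i) = -h i) (hsum : ∑ i : ZMod c, i * (h i : ZMod c) = 0)
    (u : (ZMod c)ˣ) :
    ∃ z : ℤ, ∑ j : ZMod c, sawtooth ((j.val : ℝ) / c) * h (u * j) = z := by
  have hc0 : (0 : ℝ) < c := by exact_mod_cast NeZero.pos c
  have hzero : ∑ j : ZMod c, h (u * j) = 0 := by
    have h1 : ∑ j : ZMod c, h (u * j) = ∑ j : ZMod c, -h (u * j) :=
      Fintype.sum_equiv (Equiv.neg _) _ _ fun j => by
        rw [Equiv.neg_apply, mul_neg, hodd, neg_neg]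
    rw [Finset.sum_neg_distrib] at h1
    omega
  have hzero' : ∑ j : ZMod c, (h (u * j) : ℝ) = 0 := by exact_mod_cast hzero
  have hdvd : (c : ℤ) ∣ ∑ j : ZMod c, (j.val : ℤ) * h (u * j) := by
    rw [← ZMod.intCast_zmod_eq_zero_iff_dvd]
    push_cast
    simp only [ZMod.natCast_val, ZMod.cast_id', id_eq]
    rw [← u.isUnit.mul_right_eq_zero, ← hsum, Finset.mul_sum]
    exact Fintype.sum_equiv (Units.mulLeft u) _ _ fun j => by
      rw [Units.mulLeft_apply, mul_assoc]
  obtain ⟨z, hz⟩ := hdvd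
  have hz' : ∑ j : ZMod c, (j.val : ℝ) * h (u * j) = c * z := by exact_mod_cast hz
  refine ⟨z, ?_⟩
  calc ∑ j : ZMod c, sawtooth ((j.val : ℝ) / c) * h (u * j)
      = ∑ j : ZMod c, ((j.val : ℝ) * h (u * j) / c - 1 / 2 * h (u * j)) := by
        refine Finset.sum_congr rfl fun j _ => ?_
        by_cases hj : j = 0
        · simp [hj, h0]
        · have hpos : 0 < j.val := Nat.pos_of_ne_zero ((ZMod.val_ne_zero j).2 hj)
          rw [sawtooth_of_mem_Ioo (by positivity)
            ((div_lt_one hc0).2 (by exact_mod_cast ZMod.val_lt j))]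
          ring
    _ = z := by
        rw [Finset.sum_sub_distrib, ← Finset.sum_div, ← Finset.mul_sum, hzero', hz']
        field_simp
        ring

theorem exists_int_eq_newformDedekindSum {q₁ q₂ : ℕ} [NeZero q₁] [NeZero q₂]
    (χ₁ : DirichletCharacter ℂ q₁) (χ₂ : DirichletCharacter ℂ q₂)
    (hχ₁ : χ₁ ≠ 1) (hχ₂ : χ₂ ≠ 1) (hp₁ : χ₁.IsPrimitive)
    (hpar : χ₁ (-1) * χ₂ (-1) = 1) (hquad₁ : χ₁ ^ 2 = 1) (hquad₂ : χ₂ ^ 2 = 1)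
    (hodd₁ : Odd q₁) (h4₁ : 4 < q₁) {a c : ℤ} (hc : 0 < c) (hdvd : ((q₁ * q₂ : ℕ) : ℤ) ∣ c)
    (hac : IsCoprime a c) :
    ∃ z : ℤ, newformDedekindSum χ₁ χ₂ a c = z := by
  obtain ⟨e₁, he₁, hu₁⟩ := exists_int_character χ₁ hquad₁
  obtain ⟨e₂, he₂, hu₂⟩ := exists_int_character χ₂ hquad₂
  have ne_one : ∀ {q : ℕ} {χ : DirichletCharacter ℂ q} {e : DirichletCharacter ℤ q},
      (∀ x, (e x : ℂ) = χ x) → χ ≠ 1 → e ≠ 1 := by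
    rintro q χ e he hχ rfl
    refine hχ (MulChar.ext fun u => ?_)
    rw [← he]
    simp
  have hpar' : e₁ (-1) * e₂ (-1) = 1 := by
    rw [← he₁, ← he₂] at hpar
    exact_mod_cast hpar
  obtain ⟨G, hG0, hG⟩ := exists_twistedSawtooth_eq e₁ (ne_one he₁ hχ₁)
    (sum_character_mul_self_eq_zero χ₁ hp₁ hodd₁ h4₁ e₁ he₁ hu₁)
  obtain ⟨k, rfl⟩ : ∃ k : ℕ, c = ((q₁ * (k * q₂) : ℕ) : ℤ) := by
    obtain ⟨w, rfl⟩ := hdvd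
    have hw : 0 < w := pos_of_mul_pos_right hc (by positivity)
    lift w to ℕ using hw.le
    exact ⟨w, by push_cast; ring⟩
  have hk : 0 < k := Nat.pos_of_ne_zero fun h => by simp [h] at hc
  set D := k * q₂ with hD
  have hD0 : 0 < D := Nat.mul_pos hk (NeZero.pos q₂)
  set c := q₁ * D with hcD
  have : NeZero c := ⟨by exact_mod_cast hc.ne'⟩
  have hq₂c : q₂ ∣ c := Dvd.intro_left (q₁ * k) (by rw [hcD, hD, mul_assoc])
  set h : ZMod c → ℤ := fun i => e₂ (i.val : ZMod q₂) * G ((i.val / D : ℕ) : ZMod q₁) with hh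
  have hcast : ∀ (i : ZMod c) (w : ℤ), (w : ZMod c) = i →
      ((i.val : ℕ) : ZMod q₂) = w := by
    intro i w hw
    have h1 := congrArg (ZMod.castHom hq₂c (ZMod q₂)) hw
    rw [map_intCast, ZMod.castHom_apply, ZMod.cast_eq_val] at h1
    exact h1.symm
  have hval : ∀ i : ZMod c, (e₂ (i.val : ZMod q₂) : ℝ) * twistedSawtooth e₁ ((i.val : ℝ) / c) =
      h i := by
    intro i
    by_cases hi : i.val % D = 0
    · have h1 : ((i.val : ℕ) : ZMod q₂) = 0 :=
        (ZMod.natCast_eq_zero_iff _ _).2 ((Dvd.intro_left k rfl).trans (Nat.dvd_of_mod_eq_zero hi))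
      have h2 : e₂ (0 : ZMod q₂) = 0 := by
        by_contra hne
        have hun : IsUnit (0 : ZMod q₂) := by
          by_contra hnu
          exact hne (e₂.map_nonunit hnu)
        rw [isUnit_zero_iff] at hun
        exact ne_one he₂ hχ₂ (MulChar.ext fun u => by
          rw [show (u : ZMod q₂) = 1 from by
            rw [← one_mul (u : ZMod q₂), ← hun, zero_mul]]; simp)
      rw [hh]
      simp [h1, h2, -ZMod.natCast_val]
    · have hDr : (0 : ℝ) < D := by exact_mod_cast hD0
      have hqr : (0 : ℝ) < q₁ := by exact_mod_cast NeZero.pos q₁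
      have hcr : (c : ℝ) = q₁ * D := by rw [hcD]; push_cast; ring
      have hsplit : (i.val : ℝ) / c =
          ((i.val / D : ℕ) : ℝ) / q₁ + ((i.val % D : ℕ) : ℝ) / c := by
        have h1 : (i.val : ℝ) = D * (i.val / D : ℕ) + (i.val % D : ℕ) := by
          exact_mod_cast (Nat.div_add_mod i.val D).symm
        rw [hcr, h1]
        field_simp
      have hrpos : (0 : ℝ) < (i.val % D : ℕ) := by exact_mod_cast Nat.pos_of_ne_zero hi
      have hrlt : ((i.val % D : ℕ) : ℝ) < D := by exact_mod_cast Nat.mod_lt _ hD0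
      rw [hsplit, hG _ _ (by rw [hcr]; positivity) (by
        rw [hcr, div_lt_div_iff₀ (by positivity) hqr]
        nlinarith), hh]
      push_cast
      rfl
  have hint : ∀ w : ℤ, (e₂ (w : ZMod q₂) : ℝ) * twistedSawtooth e₁ ((w : ℝ) / c) = h w := by
    intro w
    rw [← hval, hcast _ w rfl, twistedSawtooth_div_congr e₁
      (show ((w : ℤ) : ZMod c) = (((w : ZMod c).val : ℕ) : ℤ) by simp)]
    push_cast
    rfl
  have hodd : ∀ i, h (-i) = -h i := by
    intro i
    have h1 := hint (-(i.val : ℤ))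
    have h2 := hint (i.val : ℤ)
    simp only [Int.cast_neg, Int.cast_natCast, ZMod.natCast_zmod_val] at h1 h2
    rw [neg_div, twistedSawtooth_neg, neg_eq_neg_one_mul (i.val : ZMod q₂), map_mul,
      Int.cast_mul] at h1
    have h3 : ((e₁ (-1) : ℤ) : ℝ) * (e₂ (-1) : ℤ) = 1 := by exact_mod_cast hpar'
    have h4 : (h (-i) : ℝ) = -h i := by
      rw [← h1, ← h2]
      linear_combination
        -((e₂ (i.val : ZMod q₂) : ℤ) : ℝ) * twistedSawtooth e₁ ((i.val : ℝ) / c) * h3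
    exact_mod_cast h4
  have hsum : ∑ i : ZMod c, i * (h i : ZMod c) = 0 := by
    have h1 := sum_id_mul_eq_zero (q₁ := q₁) hk e₂ (ne_one he₂ hχ₂) G hG0
    rw [← hD, ← hcD, sum_range_eq_sum_zmod] at h1
    have h2 := congrArg (Int.cast : ℤ → ZMod c) h1
    rw [Int.cast_sum, Int.cast_zero] at h2
    rw [← h2]
    refine Finset.sum_congr rfl fun i _ => ?_
    rw [Int.cast_mul (i.val : ℤ), Int.cast_natCast, ZMod.natCast_zmod_val]
  have h0 : h 0 = 0 := by
    have := hodd 0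
    rw [neg_zero] at this
    omega
  have hau : IsUnit (a : ZMod c) := (ZMod.coe_int_isUnit_iff_isCoprime a c).2 hac.symm
  obtain ⟨z, hz⟩ := exists_int_eq_sum_sawtooth_mul h h0 hodd hsum hau.unit
  have hau₂ : IsUnit (a : ZMod q₂) := by
    simpa using hau.map (ZMod.castHom hq₂c (ZMod q₂))
  have hsq : e₂ a * e₂ a = 1 := by
    rcases hu₂ _ hau₂ with h1 | h1 <;> rw [h1] <;> norm_num
  have hsq' : ((e₂ a : ℤ) : ℝ) * (e₂ a : ℤ) = 1 := by exact_mod_cast hsq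
  refine ⟨e₂ a * z, ?_⟩
  rw [newformDedekindSum_eq_sum_twistedSawtooth χ₁ χ₂ e₁ e₂ he₁ he₂ a]
  have : ∑ j : ZMod c, sawtooth ((j.val : ℝ) / c) *
      (e₂ (j.val : ZMod q₂) * twistedSawtooth e₁ (((a * j.val : ℤ) : ℝ) / c)) =
      ((e₂ a * z : ℤ) : ℝ) := by
    rw [Int.cast_mul, ← hz, Finset.mul_sum]
    refine Finset.sum_congr rfl fun j _ => ?_
    have h1 := hint (a * j.val)
    have h2 : (((a * j.val : ℤ)) : ZMod c) = hau.unit * j := by simp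
    have h3 : e₂ ((a * j.val : ℤ) : ZMod q₂) = e₂ a * e₂ (j.val : ZMod q₂) := by
      rw [Int.cast_mul, map_mul, Int.cast_natCast]
    rw [h2, h3, Int.cast_mul (e₂ a)] at h1
    rw [← h1]
    linear_combination -sawtooth ((j.val : ℝ) / c) * (e₂ (j.val : ZMod q₂) : ℤ) *
      twistedSawtooth e₁ (((a * j.val : ℤ) : ℝ) / c) * hsq'
  rw [this]
  simp

theorem newform_dedekind_sum_gamma0_denominator_q2 {q₁ q₂ : ℕ} (hq₁ : 0 < q₁) (hq₂ : 0 < q₂)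
    (χ₁ : DirichletCharacter ℂ q₁) (χ₂ : DirichletCharacter ℂ q₂)
    (hχ₁ : χ₁ ≠ 1) (hχ₂ : χ₂ ≠ 1) (hp₁ : χ₁.IsPrimitive) (hp₂ : χ₂.IsPrimitive)
    (hpar : χ₁ (-1) * χ₂ (-1) = 1)
    (hquad₁ : χ₁ ^ 2 = 1) (hquad₂ : χ₂ ^ 2 = 1)
    (hodd₁ : Odd q₁) (hodd₂ : Odd q₂) (h4₁ : 4 < q₁) (h4₂ : 4 < q₂) :
    ∀ γ : Matrix.SpecialLinearGroup (Fin 2) ℤ, InGamma0 (q₁ * q₂) γ →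
      ∃ z : ℤ, (q₂ : ℂ) * newformDedekindSumSL χ₁ χ₂ γ = (z : ℂ) := by
  intro γ hγ
  have : NeZero q₁ := ⟨hq₁.ne'⟩
  have : NeZero q₂ := ⟨hq₂.ne'⟩
  have hco : IsCoprime (γ.1 0 0) (γ.1 1 0) := by
    have hdet := γ.2
    rw [Matrix.det_fin_two] at hdet
    exact ⟨γ.1 1 1, -γ.1 0 1, by linear_combination hdet⟩
  suffices h : ∃ z : ℤ, newformDedekindSumSL χ₁ χ₂ γ = z by
    obtain ⟨z, hz⟩ := h
    exact ⟨q₂ * z, by rw [hz]; push_cast; rfl⟩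
  rw [newformDedekindSumSL]
  split_ifs with h0 h1
  · exact ⟨0, by simp⟩
  · exact exists_int_eq_newformDedekindSum χ₁ χ₂ hχ₁ hχ₂ hp₁ hpar hquad₁ hquad₂ hodd₁ h4₁
      (by omega) hγ hco
  · exact exists_int_eq_newformDedekindSum χ₁ χ₂ hχ₁ hχ₂ hp₁ hpar hquad₁ hquad₂ hodd₁ h4₁
      (by omega) (dvd_neg.2 hγ) hco.neg_neg
end

section
/- For all γ₁, γ₂ ∈ Γ₀(q₁q₂), the newform Dedekind sum satisfies the crossed homomorphism property S_{χ₁,χ₂}(γ₁γ₂) = S_{χ₁,χ₂}(γ₁) + ψ(γ₁)·S_{χ₁,χ₂}(γ₂). -/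
open Complex Finset
open scoped Classical

/-! ### The sawtooth function -/

theorem sawtooth_eq (x : ℝ) :
    sawtooth x = if Int.fract x = 0 then 0 else Int.fract x - 1 / 2 := by
  simp only [sawtooth, Int.fract_eq_zero_iff, Set.mem_range]

theorem sawtooth_of_mem_Ico {x : ℝ} (h₀ : 0 ≤ x) (h₁ : x < 1) :
    sawtooth x = x - 1 / 2 + if x = 0 then 1 / 2 else 0 := by
  rw [sawtooth_eq, Int.fract_eq_self.2 ⟨h₀, h₁⟩]
  split_ifs with h
  · simp [h]
  · simp

/-- The distribution relation of the sawtooth function. -/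
theorem sum_sawtooth_add_div {m : ℕ} (hm : 0 < m) (x : ℝ) :
    ∑ k ∈ range m, sawtooth ((x + k) / m) = sawtooth x := by
  have hm' : (0 : ℝ) < m := by exact_mod_cast hm
  have shift (y : ℝ) : ∑ k ∈ range m, sawtooth ((y + 1 + k) / m) =
      ∑ k ∈ range m, sawtooth ((y + k) / m) := by
    have h₁ := sum_range_succ (fun k : ℕ => sawtooth ((y + k) / m)) m
    rw [sum_range_succ'] at h₁
    have h₂ : sawtooth ((y + m) / m) = sawtooth ((y + (0 : ℕ)) / m) := by
      rw [← sawtooth_add_int ((y + (0 : ℕ)) / m) 1]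
      congr 1
      field_simp
      simp
    rw [h₂] at h₁
    rw [← add_right_cancel h₁]
    refine sum_congr rfl fun k _ => ?_
    push_cast
    congr 2
    ring
  have hper : Function.Periodic (fun y : ℝ => ∑ k ∈ range m, sawtooth ((y + k) / m)) 1 := shift
  have h₁ : ∑ k ∈ range m, sawtooth ((x + k) / m) =
      ∑ k ∈ range m, sawtooth ((Int.fract x + k) / m) := by
    have := hper.sub_int_mul_eq (x := x) ⌊x⌋
    rw [mul_one] at this
    exact this.symm
  have h₂ : sawtooth x = sawtooth (Int.fract x) := by
    simp only [sawtooth_eq, Int.fract_fract]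
  rw [h₁, h₂]
  have hy₀ := Int.fract_nonneg x
  have hy₁ := Int.fract_lt_one x
  generalize Int.fract x = y at hy₀ hy₁
  have h₃ : ∀ k ∈ range m, sawtooth ((y + k) / m) =
      ((y / m - 1 / 2) + (k : ℝ) * (1 / m)) + if k = 0 then (if y = 0 then 1 / 2 else 0) else 0 := by
    intro k hk
    have hk' : (k : ℝ) + 1 ≤ m := by exact_mod_cast mem_range.1 hk
    have hk₀ : (0 : ℝ) ≤ k := k.cast_nonneg
    rw [sawtooth_of_mem_Ico (by positivity) (by rw [div_lt_one hm']; linarith)]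
    congr 1
    · ring
    · rcases Nat.eq_zero_or_pos k with rfl | hk
      · simp [hm'.ne']
      · have : (0 : ℝ) < k := by exact_mod_cast hk
        have : (y + k) / m ≠ 0 := by positivity
        simp [this, hk.ne']
  rw [sum_congr rfl h₃, sum_add_distrib, sum_ite_eq' , if_pos (mem_range.2 hm), sum_add_distrib,
    ← sum_mul, sawtooth_of_mem_Ico hy₀ hy₁]
  have h₄ : (∑ k ∈ range m, (k : ℝ)) = m * (m - 1) / 2 := by
    clear * -
    induction m with
    | zero => simp
    | succ n ih => rw [sum_range_succ, ih]; push_cast; ring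
  rw [h₄]
  simp only [sum_const, card_range, nsmul_eq_mul]
  field_simp
  ring

/-- The periodic second Bernoulli function. -/
noncomputable def bernoulliTwo (x : ℝ) : ℝ := Int.fract x ^ 2 - Int.fract x + 1 / 6

theorem bernoulliTwo_add_int (x : ℝ) (n : ℤ) : bernoulliTwo (x + n) = bernoulliTwo x := by
  simp only [bernoulliTwo, Int.fract_add_intCast]

theorem sawtooth_three_term {x y z : ℝ} (h : x + y + z = 0)
    (hxy : ¬(Int.fract x = 0 ∧ Int.fract y = 0)) :
    sawtooth x * sawtooth y + sawtooth y * sawtooth z + sawtooth z * sawtooth x =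
      -(1 / 2) * (bernoulliTwo x + bernoulliTwo y + bernoulliTwo z) := by
  obtain ⟨n, hn⟩ : ∃ n : ℤ, Int.fract x + Int.fract y + Int.fract z = n :=
    ⟨-⌊x⌋ - ⌊y⌋ - ⌊z⌋, by simp only [Int.fract]; push_cast; linarith⟩
  simp only [sawtooth_eq, bernoulliTwo]
  have hx₀ := Int.fract_nonneg x
  have hx₁ := Int.fract_lt_one x
  have hy₀ := Int.fract_nonneg y
  have hy₁ := Int.fract_lt_one y
  have hz₀ := Int.fract_nonneg z
  have hz₁ := Int.fract_lt_one z
  generalize Int.fract x = a at *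
  generalize Int.fract y = b at *
  generalize Int.fract z = c at *
  have h₀ : -1 < n := by exact_mod_cast (by push_cast; linarith : ((-1 : ℤ) : ℝ) < n)
  have h₃ : n < 3 := by exact_mod_cast (by push_cast; linarith : (n : ℝ) < ((3 : ℤ) : ℝ))
  obtain rfl : c = n - a - b := by linarith
  by_cases ha : a = 0
  · have hb : b ≠ 0 := fun hb => hxy ⟨ha, hb⟩
    have hb₀ : 0 < b := lt_of_le_of_ne hy₀ hb.symm
    obtain rfl : n = 1 := by
      have h₁ : (0 : ℝ) < n := by linarith
      have h₂ : (n : ℝ) < 2 := by linarith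
      norm_cast at h₁ h₂
      omega
    push_cast at *
    rw [if_pos ha, if_neg hb, if_neg (by linarith), ha]
    ring
  have ha₀ : 0 < a := lt_of_le_of_ne hx₀ (Ne.symm ha)
  by_cases hb : b = 0
  · obtain rfl : n = 1 := by
      have h₁ : (0 : ℝ) < n := by linarith
      have h₂ : (n : ℝ) < 2 := by linarith
      norm_cast at h₁ h₂
      omega
    push_cast at *
    rw [if_neg ha, if_pos hb, if_neg (by linarith), hb]
    ring
  have hb₀ : 0 < b := lt_of_le_of_ne hy₀ (Ne.symm hb)
  have h₁ : (0 : ℝ) < n := by linarith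
  norm_cast at h₁
  rw [if_neg ha, if_neg hb]
  obtain rfl | rfl : n = 1 ∨ n = 2 := by omega
  · push_cast at *
    split_ifs with hc
    · obtain rfl : b = 1 - a := by linarith
      ring
    · ring
  · push_cast at *
    rw [if_neg (by linarith)]
    ring

/-! ### Sums over a period box -/

/-- `F` is invariant under translation by `N ℤ²`. -/
def IsBoxPeriodic (N : ℕ) (F : ℤ × ℤ → ℂ) : Prop :=
  ∀ P Q : ℤ × ℤ, F (P + (N : ℤ) • Q) = F P

/-- The sum of `F` over the box `[0, N)²`. -/
noncomputable def boxSum (N : ℕ) [NeZero N] (F : ℤ × ℤ → ℂ) : ℂ :=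
  ∑ p : ZMod N × ZMod N, F ((p.1.val : ℤ), (p.2.val : ℤ))

theorem boxSum_comp {N : ℕ} [NeZero N] {F : ℤ × ℤ → ℂ} (hF : IsBoxPeriodic N F)
    (e : ZMod N × ZMod N ≃ ZMod N × ZMod N) (f : ℤ × ℤ → ℤ × ℤ)
    (h : ∀ P : ℤ × ℤ, e ((P.1 : ZMod N), (P.2 : ZMod N)) = (((f P).1 : ZMod N), ((f P).2 : ZMod N))) :
    boxSum N (fun P => F (f P)) = boxSum N F := by
  unfold boxSum
  rw [← Equiv.sum_comp e fun p => F ((p.1.val : ℤ), (p.2.val : ℤ))]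
  refine sum_congr rfl fun p _ => ?_
  have hp := h ((p.1.val : ℤ), (p.2.val : ℤ))
  simp only [Int.cast_natCast, ZMod.natCast_zmod_val, Prod.mk.eta] at hp
  rw [hp]
  simp only [ZMod.val_intCast]
  set Q := f ((p.1.val : ℤ), (p.2.val : ℤ))
  rw [← hF (Q.1 % N, Q.2 % N) (Q.1 / N, Q.2 / N)]
  congr 1
  ext
  · simp [Int.emod_add_mul_ediv]
  · simp [Int.emod_add_mul_ediv]

theorem boxSum_add_right {N : ℕ} [NeZero N] {F : ℤ × ℤ → ℂ} (hF : IsBoxPeriodic N F)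
    (w : ℤ × ℤ) : boxSum N (fun P => F (P + w)) = boxSum N F :=
  boxSum_comp hF (Equiv.addRight ((w.1 : ZMod N), (w.2 : ZMod N))) (fun P => P + w)
    fun P => by simp

theorem boxSum_eq_sum_range {N q c r s : ℕ} [NeZero N] (hq : N = q * r) (hc : N = c * s)
    {F : ℤ × ℤ → ℂ} (h₁ : ∀ i j : ℤ, F (i + q, j) = F (i, j))
    (h₂ : ∀ i j : ℤ, F (i, j + c) = F (i, j)) :
    boxSum N F = r * s * ∑ j ∈ range c, ∑ i ∈ range q, F (i, j) := by
  have zmod (f : ℤ → ℂ) : ∑ x : ZMod N, f (x.val : ℤ) = ∑ i ∈ range N, f i := by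
    obtain ⟨M, rfl⟩ := Nat.exists_eq_succ_of_ne_zero (NeZero.ne N)
    exact Fin.sum_univ_eq_sum_range (fun i : ℕ => f i) (M + 1)
  have block (f : ℤ → ℂ) (n : ℕ) (hf : ∀ i, f (i + n) = f i) (m : ℕ) :
      ∑ i ∈ range (n * m), f i = m * ∑ i ∈ range n, f i := by
    induction m with
    | zero => simp
    | succ m ih =>
      have hf' : ∀ i : ℕ, f ((n * m + i : ℕ) : ℤ) = f i := by
        intro i
        have hper : Function.Periodic f n := hf
        have := hper.int_mul m i
        rw [← this]
        push_cast
        ring_nf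
      rw [Nat.mul_succ, sum_range_add, ih, sum_congr rfl fun i _ => hf' i]
      push_cast
      ring
  unfold boxSum
  have rows (i : ℤ) := zmod fun j => F (i, j)
  rw [Fintype.sum_prod_type, zmod fun i => ∑ y : ZMod N, F (i, (y.val : ℤ))]
  simp only [rows]
  rw [sum_comm]
  have inner (j : ℤ) : ∑ i ∈ range N, F (i, j) = r * ∑ i ∈ range q, F (i, j) := by
    rw [hq]
    exact block (fun i => F (i, j)) q (fun i => h₁ i j) r
  rw [sum_congr rfl fun (j : ℕ) _ => inner j, ← mul_sum]
  have outer := block (fun j => ∑ i ∈ range q, F (i, j)) c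
    (fun j => sum_congr rfl fun i _ => h₂ i j) s
  rw [← hc] at outer
  rw [outer]
  ring

theorem boxSum_distribution {N : ℕ} [NeZero N] {G : ℤ × ℤ → ℂ} {β : ℤ × ℤ → ℝ} {w : ℤ × ℤ}
    (hG : ∀ P, G (P + w) = G P) (hβ : ∀ P, β (P + w) = β P + 1) {m : ℤ} (hm : m ≠ 0)
    (hper : IsBoxPeriodic N fun P => G P * (sawtooth (β P / m) : ℂ)) :
    m * boxSum N (fun P => G P * (sawtooth (β P / m) : ℂ)) =
      boxSum N (fun P => G P * (sawtooth (β P) : ℂ)) := by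
  have key {n : ℕ} (hn : 0 < n)
      (hper : IsBoxPeriodic N fun P => G P * (sawtooth (β P / n) : ℂ)) :
      n * boxSum N (fun P => G P * (sawtooth (β P / n) : ℂ)) =
        boxSum N (fun P => G P * (sawtooth (β P) : ℂ)) := by
    have hG' : ∀ (k : ℕ) P, G (P + k • w) = G P := by
      intro k P
      induction k with
      | zero => simp
      | succ k ih => rw [succ_nsmul, ← add_assoc, hG, ih]
    have hβ' : ∀ (k : ℕ) P, β (P + k • w) = β P + k := by
      intro k P
      induction k with
      | zero => simp
      | succ k ih => rw [succ_nsmul, ← add_assoc, hβ, ih]; push_cast; ring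
    have h₁ : ∀ k ∈ range n, boxSum N (fun P => G P * (sawtooth ((β P + k) / n) : ℂ)) =
        boxSum N (fun P => G P * (sawtooth (β P / n) : ℂ)) := by
      intro k _
      rw [← boxSum_add_right hper (k • w)]
      simp only [hG', hβ']
    have h₂ := sum_congr rfl h₁
    rw [sum_const, card_range, nsmul_eq_mul] at h₂
    rw [← h₂]
    unfold boxSum
    rw [sum_comm]
    refine sum_congr rfl fun p _ => ?_
    rw [← mul_sum, ← Complex.ofReal_sum, sum_sawtooth_add_div hn]
  obtain h | h := lt_or_gt_of_ne hm
  · obtain ⟨n, rfl⟩ : ∃ n : ℕ, m = -n := ⟨m.natAbs, by omega⟩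
    have hn : 0 < n := by omega
    have hs : ∀ P, G P * (sawtooth (β P / ((-(n : ℤ) : ℤ) : ℝ)) : ℂ) =
        -(G P * (sawtooth (β P / n) : ℂ)) := by
      intro P
      push_cast
      rw [div_neg, sawtooth_neg]
      push_cast
      ring
    simp only [hs] at hper ⊢
    have hper' : IsBoxPeriodic N fun P => G P * (sawtooth (β P / n) : ℂ) :=
      fun P Q => neg_injective (hper P Q)
    rw [← key hn hper']
    simp [boxSum]
  · obtain ⟨n, rfl⟩ : ∃ n : ℕ, m = n := ⟨m.natAbs, by omega⟩
    have hn : 0 < n := by omega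
    simp only [Int.cast_natCast] at hper ⊢
    exact key hn hper

/-! ### Dedekind sums attached to pairs of vectors -/

/-- The determinant of a pair of integral vectors. -/
def det₂ (u v : ℤ × ℤ) : ℤ := u.1 * v.2 - u.2 * v.1

theorem det₂_add_smul_left (P Q v : ℤ × ℤ) (n : ℤ) :
    det₂ (P + n • Q) v = det₂ P v + n * det₂ Q v := by
  simp [det₂]; ring

theorem det₂_add_left (P Q v : ℤ × ℤ) : det₂ (P + Q) v = det₂ P v + det₂ Q v := by
  simp [det₂]; ring

theorem det₂_add_right (P Q v : ℤ × ℤ) : det₂ v (P + Q) = det₂ v P + det₂ v Q := by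
  simp [det₂]; ring

theorem det₂_self (u : ℤ × ℤ) : det₂ u u = 0 := by
  simp [det₂]; ring

theorem det₂_swap (u v : ℤ × ℤ) : det₂ v u = -det₂ u v := by
  simp [det₂]; ring

/-- `N²` times the sum of `g(P) B₁(α) B₁(β)` over `P = α u + β v` modulo `ℤ u + ℤ v`,
taken with the sign of `det₂ u v`; it vanishes when `u` and `v` are dependent. -/
noncomputable def dedekindPair (N : ℕ) [NeZero N] (g : ℤ × ℤ → ℂ) (u v : ℤ × ℤ) : ℂ :=
  det₂ u v * boxSum N fun P =>
    g P * (sawtooth (det₂ P v / det₂ u v) : ℂ) * (sawtooth (det₂ u P / det₂ u v) : ℂ)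

theorem dedekindPair_of_det₂_eq_zero (N : ℕ) [NeZero N] (g : ℤ × ℤ → ℂ) {u v : ℤ × ℤ}
    (h : det₂ u v = 0) : dedekindPair N g u v = 0 := by
  simp [dedekindPair, h]

theorem dedekindPair_swap (N : ℕ) [NeZero N] (g : ℤ × ℤ → ℂ) (u v : ℤ × ℤ) :
    dedekindPair N g v u = -dedekindPair N g u v := by
  unfold dedekindPair
  rw [det₂_swap u v]
  have h : ∀ P, g P * (sawtooth (det₂ P u / ((-det₂ u v : ℤ) : ℝ)) : ℂ) *
      (sawtooth (det₂ v P / ((-det₂ u v : ℤ) : ℝ)) : ℂ) =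
      g P * (sawtooth (det₂ P v / det₂ u v) : ℂ) * (sawtooth (det₂ u P / det₂ u v) : ℂ) := by
    intro P
    rw [det₂_swap u P, det₂_swap P v]
    push_cast
    rw [neg_div_neg_eq, neg_div_neg_eq]
    ring
  simp only [h]
  push_cast
  ring

theorem dedekindPair_neg_right (N : ℕ) [NeZero N] (g : ℤ × ℤ → ℂ) (u v : ℤ × ℤ) :
    dedekindPair N g u (-v) = dedekindPair N g u v := by
  have hneg : ∀ w : ℤ × ℤ, det₂ w (-v) = -det₂ w v := fun w => by simp [det₂]; ring
  unfold dedekindPair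
  have h : ∀ P, g P * (sawtooth (det₂ P (-v) / det₂ u (-v)) : ℂ) *
      (sawtooth (det₂ u P / det₂ u (-v)) : ℂ) =
      -(g P * (sawtooth (det₂ P v / det₂ u v) : ℂ) * (sawtooth (det₂ u P / det₂ u v) : ℂ)) := by
    intro P
    rw [hneg, hneg]
    push_cast
    rw [neg_div_neg_eq, div_neg, sawtooth_neg]
    push_cast
    ring
  simp only [h]
  rw [hneg]
  simp [boxSum]

theorem dedekindPair_neg_left (N : ℕ) [NeZero N] (g : ℤ × ℤ → ℂ) (u v : ℤ × ℤ) :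
    dedekindPair N g (-u) v = dedekindPair N g u v := by
  rw [dedekindPair_swap, dedekindPair_neg_right, ← dedekindPair_swap]

theorem sawtooth_det₂_periodic {N : ℕ} {D : ℤ} (hD : D ∣ N) (hD₀ : D ≠ 0) (P Q v : ℤ × ℤ) :
    sawtooth (det₂ (P + (N : ℤ) • Q) v / D) = sawtooth (det₂ P v / D) := by
  obtain ⟨r, hr⟩ := hD
  rw [← sawtooth_add_int (det₂ P v / D) (r * det₂ Q v), det₂_add_smul_left, hr]
  congr 1
  have : (D : ℝ) ≠ 0 := by exact_mod_cast hD₀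
  push_cast
  field_simp

theorem sawtooth_det₂_periodic' {N : ℕ} {D : ℤ} (hD : D ∣ N) (hD₀ : D ≠ 0) (P Q v : ℤ × ℤ) :
    sawtooth (det₂ v (P + (N : ℤ) • Q) / D) = sawtooth (det₂ v P / D) := by
  rw [det₂_swap _ v, det₂_swap P v]
  push_cast
  rw [neg_div, neg_div, sawtooth_neg, sawtooth_neg, sawtooth_det₂_periodic hD hD₀]

/-- Scaling the lattice spanned by `u` and `v`, by the distribution relation. -/
theorem dedekindPair_scale {N : ℕ} [NeZero N] {g : ℤ × ℤ → ℂ} (hg : IsBoxPeriodic N g)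
    {u v : ℤ × ℤ} (hu : ∀ P, g (P + u) = g P) (hv : ∀ P, g (P + v) = g P) {D m₁ m₂ : ℤ}
    (hD : det₂ u v = D) (hD₀ : D ≠ 0) (h₁ : m₁ ≠ 0) (h₂ : m₂ ≠ 0) (hN : D * m₁ * m₂ ∣ N) :
    dedekindPair N g u v = -(D * m₁ * m₂) * boxSum N fun P =>
      g P * (sawtooth (det₂ P v / (D * m₁)) : ℂ) * (sawtooth (det₂ P u / (D * m₂)) : ℂ) := by
  have hDr : (D : ℝ) ≠ 0 := by exact_mod_cast hD₀
  have hN₁ : D * m₁ ∣ N := (Dvd.intro _ rfl).trans hN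
  have hN₂ : D * m₂ ∣ N := (Dvd.intro m₁ (by ring)).trans hN
  have hN₀ : D ∣ N := (Dvd.intro _ rfl).trans hN₁
  have stepα := boxSum_distribution (N := N)
    (G := fun P => g P * (sawtooth (det₂ u P / D) : ℂ)) (β := fun P => (det₂ P v : ℝ) / D)
    (w := u) (m := m₁)
    (fun P => by
      simp only [det₂_add_right, hu, det₂_self, add_zero])
    (fun P => by
      simp only [det₂_add_left, hD]
      push_cast
      field_simp) h₁
    (fun P Q => by
      have hq := sawtooth_det₂_periodic hN₁ (mul_ne_zero hD₀ h₁) P Q v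
      push_cast at hq
      simp only [div_div, hg P Q, sawtooth_det₂_periodic' hN₀ hD₀, hq])
  have stepβ := boxSum_distribution (N := N)
    (G := fun P => g P * (sawtooth (det₂ P v / (D * m₁)) : ℂ))
    (β := fun P => (det₂ u P : ℝ) / D) (w := v) (m := -m₂)
    (fun P => by
      simp only [det₂_add_left, hv, det₂_self, add_zero])
    (fun P => by
      simp only [det₂_add_right, hD]
      push_cast
      field_simp) (neg_ne_zero.2 h₂)
    (fun P Q => by
      have hq := sawtooth_det₂_periodic hN₁ (mul_ne_zero hD₀ h₁) P Q v
      have hq₂ := sawtooth_det₂_periodic' (neg_dvd.2 hN₂)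
        (neg_ne_zero.2 (mul_ne_zero hD₀ h₂)) P Q u
      push_cast at hq hq₂
      simp only [div_div, hg P Q, hq]
      push_cast
      simp only [mul_neg, hq₂])
  have hs : ∀ P, (det₂ u P : ℝ) / D / ((-m₂ : ℤ) : ℝ) = det₂ P u / (D * m₂) := by
    intro P
    rw [det₂_swap P u]
    push_cast
    rw [div_div, mul_neg, neg_div_neg_eq]
  simp only [hs] at stepβ
  simp only [div_div] at stepα
  have hc₁ : ∀ P, g P * (sawtooth (det₂ u P / D) : ℂ) * (sawtooth (det₂ P v / (D * m₁)) : ℂ) =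
      g P * (sawtooth (det₂ P v / (D * m₁)) : ℂ) * (sawtooth (det₂ u P / D) : ℂ) :=
    fun P => by ring
  have hc₂ : ∀ P, g P * (sawtooth (det₂ u P / D) : ℂ) * (sawtooth (det₂ P v / D) : ℂ) =
      g P * (sawtooth (det₂ P v / D) : ℂ) * (sawtooth (det₂ u P / D) : ℂ) :=
    fun P => by ring
  simp only [hc₁, hc₂] at stepα
  unfold dedekindPair
  rw [hD, ← stepα, ← stepβ]
  push_cast
  ring

/-- `u` is negligible for `g`: functions of `det₂ · u` have zero `g`-weighted sum. -/
def IsNegligible (N : ℕ) [NeZero N] (g : ℤ × ℤ → ℂ) (u : ℤ × ℤ) : Prop :=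
  ∀ H : ℤ → ℂ, (∀ x y, H (x + N * y) = H x) → boxSum N (fun P => g P * H (det₂ P u)) = 0

theorem IsNegligible.boxSum_bernoulliTwo {N : ℕ} [NeZero N] {g : ℤ × ℤ → ℂ} {u : ℤ × ℤ}
    (hu : IsNegligible N g u) {D : ℤ} (hD : D ∣ N) (hD₀ : D ≠ 0) :
    boxSum N (fun P => g P * (bernoulliTwo (det₂ P u / D) : ℂ)) = 0 := by
  refine hu (fun x => (bernoulliTwo (x / D) : ℂ)) fun x y => ?_
  obtain ⟨r, hr⟩ := hD
  have hr' : (N : ℤ) * y = D * r * y := by rw [hr]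
  simp only [hr']
  rw [← bernoulliTwo_add_int (x / D) (r * y)]
  congr 2
  have : (D : ℝ) ≠ 0 := by exact_mod_cast hD₀
  push_cast
  field_simp

theorem dedekindPair_three_term {N : ℕ} [NeZero N] {g : ℤ × ℤ → ℂ} (hg : IsBoxPeriodic N g)
    (hg₀ : g 0 = 0) {u v t : ℤ × ℤ} (hu : ∀ P, g (P + u) = g P) (hv : ∀ P, g (P + v) = g P)
    (ht : ∀ P, g (P + t) = g P) (hu' : IsNegligible N g u) (hv' : IsNegligible N g v)
    (ht' : IsNegligible N g t) (huv : det₂ u v ≠ 0) (hvt : det₂ v t ≠ 0) (htu : det₂ t u ≠ 0)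
    (hN : det₂ v t * det₂ t u * det₂ u v ∣ N) :
    dedekindPair N g u v + dedekindPair N g v t + dedekindPair N g t u = 0 := by
  obtain ⟨A, hA⟩ : ∃ A, det₂ v t = A := ⟨_, rfl⟩
  obtain ⟨B, hB⟩ : ∃ B, det₂ t u = B := ⟨_, rfl⟩
  obtain ⟨C, hC⟩ : ∃ C, det₂ u v = C := ⟨_, rfl⟩
  rw [hA] at hvt hN
  rw [hB] at htu hN
  rw [hC] at huv hN
  have hAr : (A : ℝ) ≠ 0 := by exact_mod_cast hvt
  have hBr : (B : ℝ) ≠ 0 := by exact_mod_cast htu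
  have hCr : (C : ℝ) ≠ 0 := by exact_mod_cast huv
  rw [dedekindPair_scale hg hu hv hC huv hvt htu (by convert hN using 1; ring),
    dedekindPair_scale hg hv ht hA hvt htu huv (by convert hN using 1),
    dedekindPair_scale hg ht hu hB htu huv hvt (by convert hN using 1; ring)]
  have hx := hu'.boxSum_bernoulliTwo ((Dvd.intro_left A (by ring)).trans hN) (mul_ne_zero htu huv)
  have hy := hv'.boxSum_bernoulliTwo ((Dvd.intro_left B (by ring)).trans hN) (mul_ne_zero huv hvt)
  have hz := ht'.boxSum_bernoulliTwo ((Dvd.intro_left C (by ring)).trans hN) (mul_ne_zero hvt htu)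
  have hgu : ∀ (n : ℤ) P, g (P + n • u) = g P := fun n P =>
    (show Function.Periodic g u from hu).zsmul n P
  have hgv : ∀ (n : ℤ) P, g (P + n • v) = g P := fun n P =>
    (show Function.Periodic g v from hv).zsmul n P
  have pointwise : ∀ P, g P * (sawtooth (det₂ P v / (C * A)) : ℂ) *
        (sawtooth (det₂ P u / (C * B)) : ℂ) +
      g P * (sawtooth (det₂ P t / (A * B)) : ℂ) * (sawtooth (det₂ P v / (A * C)) : ℂ) +
      g P * (sawtooth (det₂ P u / (B * C)) : ℂ) * (sawtooth (det₂ P t / (B * A)) : ℂ) =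
      -(1 / 2) * (g P * (bernoulliTwo (det₂ P u / ((B * C : ℤ) : ℝ)) : ℂ) +
        g P * (bernoulliTwo (det₂ P v / ((C * A : ℤ) : ℝ)) : ℂ) +
        g P * (bernoulliTwo (det₂ P t / ((A * B : ℤ) : ℝ)) : ℂ)) := by
    intro P
    by_cases hint : Int.fract ((det₂ P u : ℝ) / (B * C)) = 0 ∧
        Int.fract ((det₂ P v : ℝ) / (C * A)) = 0
    · suffices g P = 0 by simp [this]
      simp only [Int.fract_eq_zero_iff, Set.mem_range] at hint
      obtain ⟨⟨m, hm⟩, n, hn⟩ := hint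
      rw [eq_div_iff (mul_ne_zero hBr hCr)] at hm
      rw [eq_div_iff (mul_ne_zero hCr hAr)] at hn
      norm_cast at hm hn
      have hP : P = 0 + (n * A) • u + (-(m * B)) • v := by
        ext
        · apply mul_left_cancel₀ huv
          simp only [← hC, det₂, Prod.fst_add, Prod.smul_fst, smul_eq_mul, Prod.fst_zero] at hm hn ⊢
          linear_combination v.1 * hm - u.1 * hn
        · apply mul_left_cancel₀ huv
          simp only [← hC, det₂, Prod.snd_add, Prod.smul_snd, smul_eq_mul, Prod.snd_zero] at hm hn ⊢
          linear_combination v.2 * hm - u.2 * hn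
      rw [hP, hgv, hgu, hg₀]
    · have hsum : (det₂ P u : ℝ) / (B * C) + (det₂ P v : ℝ) / (C * A) +
          (det₂ P t : ℝ) / (A * B) = 0 := by
        have : A * det₂ P u + B * det₂ P v + C * det₂ P t = 0 := by
          rw [← hA, ← hB, ← hC]
          simp only [det₂]
          ring
        have : (A : ℝ) * det₂ P u + B * det₂ P v + C * det₂ P t = 0 := by exact_mod_cast this
        field_simp
        linear_combination this
      have h3 := congrArg (fun x : ℝ => g P * (x : ℂ)) (sawtooth_three_term hsum hint)
      push_cast at h3 ⊢
      rw [mul_comm (C : ℝ) B, mul_comm (A : ℝ) C, mul_comm (B : ℝ) A]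
      linear_combination h3
  have total : boxSum N (fun P => g P * (sawtooth (det₂ P v / (C * A)) : ℂ) *
        (sawtooth (det₂ P u / (C * B)) : ℂ)) +
      boxSum N (fun P => g P * (sawtooth (det₂ P t / (A * B)) : ℂ) *
        (sawtooth (det₂ P v / (A * C)) : ℂ)) +
      boxSum N (fun P => g P * (sawtooth (det₂ P u / (B * C)) : ℂ) *
        (sawtooth (det₂ P t / (B * A)) : ℂ)) = 0 := by
    unfold boxSum at hx hy hz ⊢
    rw [← sum_add_distrib, ← sum_add_distrib]
    simp only [pointwise]
    rw [← mul_sum, sum_add_distrib, sum_add_distrib, hx, hy, hz]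
    simp
  linear_combination -(A * B * C : ℂ) * total

theorem dedekindPair_map {N : ℕ} [NeZero N] {g : ℤ × ℤ → ℂ} (hg : IsBoxPeriodic N g)
    {a b c d : ℤ} (hM : a * d - b * c = 1) {f : ℤ × ℤ → ℤ × ℤ}
    (hf : ∀ P, f P = (a * P.1 + b * P.2, c * P.1 + d * P.2)) {s : ℂ} (hs : ∀ P, g (f P) = s * g P)
    {u v : ℤ × ℤ} (hN : det₂ u v ∣ N) :
    dedekindPair N g (f u) (f v) = s * dedekindPair N g u v := by
  have hdet : ∀ P Q, det₂ (f P) (f Q) = det₂ P Q := by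
    intro P Q
    simp only [hf, det₂]
    linear_combination (P.1 * Q.2 - P.2 * Q.1) * hM
  by_cases hD₀ : det₂ u v = 0
  · rw [dedekindPair_of_det₂_eq_zero N g hD₀, dedekindPair_of_det₂_eq_zero N g (by rw [hdet, hD₀]),
      mul_zero]
  have hM' : (a * d - b * c : ZMod N) = 1 := by exact_mod_cast congrArg (Int.cast (R := ZMod N)) hM
  let e : ZMod N × ZMod N ≃ ZMod N × ZMod N :=
    { toFun := fun p => (a * p.1 + b * p.2, c * p.1 + d * p.2)
      invFun := fun p => (d * p.1 - b * p.2, -c * p.1 + a * p.2)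
      left_inv := fun p => by
        ext
        · linear_combination p.1 * hM'
        · linear_combination p.2 * hM'
      right_inv := fun p => by
        ext
        · linear_combination p.1 * hM'
        · linear_combination p.2 * hM' }
  unfold dedekindPair
  rw [hdet]
  rw [← boxSum_comp (N := N) (f := f) (e := e)]
  · simp only [hs, hdet]
    simp only [boxSum, mul_sum]
    refine sum_congr rfl fun p _ => ?_
    ring
  · intro P Q
    simp only [hg P Q, sawtooth_det₂_periodic hN hD₀, sawtooth_det₂_periodic' hN hD₀]
  · intro P
    simp [e, hf]

theorem dedekindPair_cocycle {N : ℕ} [NeZero N] {g : ℤ × ℤ → ℂ} (hg : IsBoxPeriodic N g)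
    (hg₀ : g 0 = 0) {u v t : ℤ × ℤ} (hu : ∀ P, g (P + u) = g P) (hv : ∀ P, g (P + v) = g P)
    (ht : ∀ P, g (P + t) = g P) (hu' : IsNegligible N g u) (hv' : IsNegligible N g v)
    (ht' : IsNegligible N g t) (huv : det₂ u v = 0 → v = u ∨ v = -u)
    (hvt : det₂ v t = 0 → t = v ∨ t = -v) (htu : det₂ t u = 0 → u = t ∨ u = -t)
    (hN : det₂ u v ≠ 0 → det₂ v t ≠ 0 → det₂ t u ≠ 0 → det₂ v t * det₂ t u * det₂ u v ∣ N) :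
    dedekindPair N g u v + dedekindPair N g v t + dedekindPair N g t u = 0 := by
  have degenerate {u v t : ℤ × ℤ} (h₀ : det₂ u v = 0) (h : v = u ∨ v = -u) :
      dedekindPair N g u v + dedekindPair N g v t + dedekindPair N g t u = 0 := by
    rw [dedekindPair_of_det₂_eq_zero N g h₀, dedekindPair_swap N g u t]
    obtain rfl | rfl := h
    · ring
    · rw [dedekindPair_neg_left]
      ring
  by_cases h₁ : det₂ u v = 0
  · exact degenerate h₁ (huv h₁)
  by_cases h₂ : det₂ v t = 0
  · rw [← degenerate (t := u) h₂ (hvt h₂)]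
    ring
  by_cases h₃ : det₂ t u = 0
  · rw [← degenerate (t := v) h₃ (htu h₃)]
    ring
  exact dedekindPair_three_term hg hg₀ hu hv ht hu' hv' ht' h₁ h₂ h₃ (hN h₁ h₂ h₃)

/-! ### The weight attached to a pair of Dirichlet characters -/

section charWeight

variable {q₁ q₂ : ℕ} (χ₁ : DirichletCharacter ℂ q₁) (χ₂ : DirichletCharacter ℂ q₂)

/-- The weight `P ↦ conj χ₂(P₂) conj χ₁(P₁)` on integral vectors. -/
noncomputable def charWeight (P : ℤ × ℤ) : ℂ :=
  (starRingEnd ℂ) (χ₂ (P.2 : ZMod q₂)) * (starRingEnd ℂ) (χ₁ (P.1 : ZMod q₁))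

theorem charWeight_add {Q : ℤ × ℤ} (h₁ : (q₁ : ℤ) ∣ Q.1) (h₂ : (q₂ : ℤ) ∣ Q.2) (P : ℤ × ℤ) :
    charWeight χ₁ χ₂ (P + Q) = charWeight χ₁ χ₂ P := by
  rw [← ZMod.intCast_zmod_eq_zero_iff_dvd] at h₁ h₂
  simp [charWeight, h₁, h₂]

theorem charWeight_periodic {N : ℕ} (h₁ : q₁ ∣ N) (h₂ : q₂ ∣ N) :
    IsBoxPeriodic N (charWeight χ₁ χ₂) := fun P Q =>
  charWeight_add χ₁ χ₂ ((Int.natCast_dvd_natCast.2 h₁).mul_right Q.1)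
    ((Int.natCast_dvd_natCast.2 h₂).mul_right Q.2) P

variable {χ₁}

theorem isNegligible_charWeight [NeZero q₁] (hχ₁ : χ₁ ≠ 1) {N : ℕ} [NeZero N] (h₁ : q₁ ∣ N)
    (h₂ : q₂ ∣ N) {a k : ℤ} (ha : IsUnit (a : ZMod q₁)) (hk : (q₂ : ℤ) ∣ k) :
    IsNegligible N (charWeight χ₁ χ₂) (q₁ * a, -(q₁ * k)) := by
  intro H hH
  have hper : IsBoxPeriodic N fun P =>
      charWeight χ₁ χ₂ P * H (det₂ P (q₁ * a, -(q₁ * k))) := by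
    intro P Q
    simp only [charWeight_periodic χ₁ χ₂ h₁ h₂ P Q, det₂_add_smul_left, hH]
  have hshift (s : ℕ) : boxSum N (fun P => (starRingEnd ℂ) (χ₂ (P.2 : ZMod q₂)) *
      (starRingEnd ℂ) (χ₁ (P.1 + s * a : ZMod q₁)) * H (det₂ P (q₁ * a, -(q₁ * k)))) =
      boxSum N fun P => charWeight χ₁ χ₂ P * H (det₂ P (q₁ * a, -(q₁ * k))) := by
    rw [← boxSum_add_right hper (s * a, -(s * k))]
    congr 1
    funext P
    have hdet : det₂ (P + (s * a, -(s * k))) (q₁ * a, -(q₁ * k)) =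
        det₂ P (q₁ * a, -(q₁ * k)) := by
      simp only [det₂, Prod.fst_add, Prod.snd_add]
      ring
    have hk' := (ZMod.intCast_zmod_eq_zero_iff_dvd k q₂).2 hk
    simp [hdet, charWeight, hk']
  have hsum : ∑ s : ZMod q₁, boxSum N (fun P => (starRingEnd ℂ) (χ₂ (P.2 : ZMod q₂)) *
      (starRingEnd ℂ) (χ₁ (P.1 + (s.val : ℕ) * a : ZMod q₁)) *
        H (det₂ P (q₁ * a, -(q₁ * k)))) = 0 := by
    unfold boxSum
    rw [sum_comm]
    refine sum_eq_zero fun p _ => ?_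
    rw [← sum_mul, ← mul_sum, ← map_sum]
    simp only [ZMod.natCast_zmod_val]
    obtain ⟨b, hb⟩ := ha
    rw [← hb]
    have := Equiv.sum_comp (b.mulRight.trans (Equiv.addLeft (((p.1.val : ℤ) : ZMod q₁))))
      fun x => χ₁ x
    simp only [Equiv.trans_apply, Units.mulRight_apply, Equiv.coe_addLeft] at this
    rw [this, MulChar.sum_eq_zero_of_ne_one hχ₁]
    simp
  rw [sum_congr rfl fun s _ => hshift s.val, sum_const, card_univ, ZMod.card,
    nsmul_eq_mul] at hsum
  exact (mul_eq_zero.1 hsum).resolve_left (by exact_mod_cast NeZero.ne q₁)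

variable (χ₁)

theorem dedekindPair_charWeight [NeZero q₁] {N : ℕ} [NeZero N] {a c : ℤ} (hc : 0 < c)
    (hq₂ : (q₂ : ℤ) ∣ c) (hN : (q₁ : ℤ) * c ∣ N) :
    dedekindPair N (charWeight χ₁ χ₂) (q₁, 0) (q₁ * a, -c) =
      N ^ 2 * newformDedekindSum χ₁ χ₂ a c := by
  lift c to ℕ using hc.le
  have hc₀ : 0 < c := by exact_mod_cast hc
  have hcr : (c : ℝ) ≠ 0 := by exact_mod_cast hc₀.ne'
  have hq : (q₁ : ℝ) ≠ 0 := by exact_mod_cast NeZero.ne q₁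
  have hN' : q₁ * c ∣ N := by exact_mod_cast hN
  obtain ⟨r, hr⟩ := hN'
  have hdet : det₂ (q₁, 0) (q₁ * a, -c) = -(q₁ * c) := by simp [det₂]
  have harg₁ (P : ℤ × ℤ) : (det₂ P (q₁ * a, -c) : ℝ) / ((-(q₁ * c) : ℤ) : ℝ) =
      P.1 / q₁ + a * P.2 / c := by
    simp only [det₂]
    push_cast
    field_simp
    ring
  have harg₂ (P : ℤ × ℤ) : (det₂ (q₁, 0) P : ℝ) / ((-(q₁ * c) : ℤ) : ℝ) = -(P.2 / c) := by
    simp only [det₂]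
    push_cast
    field_simp
    ring
  unfold dedekindPair
  simp only [hdet, harg₁, harg₂, sawtooth_neg]
  rw [boxSum_eq_sum_range (q := q₁) (c := c) (r := c * r) (s := q₁ * r) (by rw [hr]; ring)
    (by rw [hr]; ring)]
  · rw [newformDedekindSum, hr, Int.toNat_natCast]
    simp only [mul_sum]
    refine sum_congr rfl fun j _ => sum_congr rfl fun i _ => ?_
    simp only [charWeight]
    push_cast
    ring
  · intro i j
    have h₁ := charWeight_add χ₁ χ₂ (Q := (q₁, 0)) dvd_rfl (dvd_zero _) (i, j)
    rw [Prod.mk_add_mk, add_zero] at h₁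
    have h₂ := sawtooth_add_int ((i : ℝ) / q₁ + a * j / c) 1
    simp only [h₁]
    rw [← h₂]
    congr 4
    push_cast
    field_simp
    ring
  · intro i j
    have h₁ := charWeight_add χ₁ χ₂ (Q := (0, c)) (dvd_zero _) hq₂ (i, j)
    rw [Prod.mk_add_mk, add_zero] at h₁
    have h₂ := sawtooth_add_int ((i : ℝ) / q₁ + a * j / c) a
    have h₃ := sawtooth_add_int ((j : ℝ) / c) 1
    simp only [h₁]
    rw [← h₂, ← h₃]
    congr 4
    · push_cast
      field_simp
      ring
    · push_cast
      field_simp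

/-- The first column of a matrix, rescaled by `q` in the first and by `-1` in the second entry. -/
def firstColumn (q : ℕ) (γ : Matrix.SpecialLinearGroup (Fin 2) ℤ) : ℤ × ℤ :=
  (q * γ.1 0 0, -γ.1 1 0)

theorem dedekindPair_firstColumn [NeZero q₁] {N : ℕ} [NeZero N]
    {γ : Matrix.SpecialLinearGroup (Fin 2) ℤ} (hγ : InGamma0 (q₁ * q₂) γ)
    (hN : γ.1 1 0 ≠ 0 → (q₁ : ℤ) * γ.1 1 0 ∣ N) :
    dedekindPair N (charWeight χ₁ χ₂) (q₁, 0) (firstColumn q₁ γ) =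
      N ^ 2 * newformDedekindSumSL χ₁ χ₂ γ := by
  have hq₂ : (q₂ : ℤ) ∣ γ.1 1 0 := (Int.natCast_dvd_natCast.2 (Dvd.intro_left q₁ rfl)).trans hγ
  unfold newformDedekindSumSL firstColumn
  split_ifs with h₀ h₁
  · rw [mul_zero]
    exact dedekindPair_of_det₂_eq_zero _ _ (by simp [det₂, h₀])
  · exact dedekindPair_charWeight χ₁ χ₂ h₁ hq₂ (hN h₀)
  · rw [← dedekindPair_charWeight χ₁ χ₂ (by omega) (by rwa [dvd_neg])
      (by rw [mul_neg, neg_dvd]; exact hN h₀), ← dedekindPair_neg_right]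
    congr 1
    ext <;> simp

end charWeight

theorem newform_dedekind_sum_crossed_homomorphism {q₁ q₂ : ℕ} (hq₁ : 0 < q₁) (hq₂ : 0 < q₂)
    (χ₁ : DirichletCharacter ℂ q₁) (χ₂ : DirichletCharacter ℂ q₂)
    (hχ₁ : χ₁ ≠ 1) (hχ₂ : χ₂ ≠ 1) (hp₁ : χ₁.IsPrimitive) (hp₂ : χ₂.IsPrimitive)
    (hpar : χ₁ (-1) * χ₂ (-1) = 1)
    (γ₁ γ₂ : Matrix.SpecialLinearGroup (Fin 2) ℤ)
    (hγ₁ : InGamma0 (q₁ * q₂) γ₁) (hγ₂ : InGamma0 (q₁ * q₂) γ₂) :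
    newformDedekindSumSL χ₁ χ₂ (γ₁ * γ₂) =
      newformDedekindSumSL χ₁ χ₂ γ₁ +
        χ₁ ((γ₁.1 1 1 : ℤ) : ZMod q₁) * (starRingEnd ℂ) (χ₂ ((γ₁.1 1 1 : ℤ) : ZMod q₂)) *
          newformDedekindSumSL χ₁ χ₂ γ₂ := by
  have : NeZero q₁ := ⟨hq₁.ne'⟩
  have : NeZero q₂ := ⟨hq₂.ne'⟩
  obtain ⟨l₁, hl₁⟩ := id hγ₁
  obtain ⟨l₂, hl₂⟩ := id hγ₂
  have hdet₁ := γ₁.det_coe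
  have hdet₂ := γ₂.det_coe
  have hdet₁₂ := (γ₁ * γ₂).det_coe
  rw [Matrix.det_fin_two] at hdet₁ hdet₂ hdet₁₂
  have ha₁₂ : (γ₁ * γ₂).1 0 0 = γ₁.1 0 0 * γ₂.1 0 0 + γ₁.1 0 1 * γ₂.1 1 0 := by
    simp [Matrix.mul_apply, Fin.sum_univ_two]
  have hc₁₂ : (γ₁ * γ₂).1 1 0 = γ₁.1 1 0 * γ₂.1 0 0 + γ₁.1 1 1 * γ₂.1 1 0 := by
    simp [Matrix.mul_apply, Fin.sum_univ_two]
  have hl₁₂ : (γ₁ * γ₂).1 1 0 = ((q₁ * q₂ : ℕ) : ℤ) * (l₁ * γ₂.1 0 0 + γ₁.1 1 1 * l₂) := by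
    rw [hc₁₂, hl₁, hl₂]
    ring
  have hγ₁₂ : InGamma0 (q₁ * q₂) (γ₁ * γ₂) := ⟨_, hl₁₂⟩
  have exists_multiple (x : ℤ) : ∃ m : ℕ, m ≠ 0 ∧ (x ≠ 0 → x ∣ m) := by
    by_cases hx : x = 0
    · exact ⟨1, one_ne_zero, fun h => absurd hx h⟩
    · exact ⟨x.natAbs, Int.natAbs_ne_zero.2 hx, fun _ => Int.dvd_natAbs_self⟩
  obtain ⟨m₁, hm₁, hd₁⟩ := exists_multiple (γ₁.1 1 0)
  obtain ⟨m₂, hm₂, hd₂⟩ := exists_multiple (γ₂.1 1 0)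
  obtain ⟨m₁₂, hm₁₂, hd₁₂⟩ := exists_multiple ((γ₁ * γ₂).1 1 0)
  obtain ⟨N, hN⟩ : ∃ N, N = q₂ * (q₁ * m₁) * (q₁ * m₂) * (q₁ * m₁₂) := ⟨_, rfl⟩
  have hN₀ : NeZero N := ⟨by
    rw [hN]
    have := hq₁.ne'
    have := hq₂.ne'
    positivity⟩
  have hNz : (N : ℤ) = q₂ * (q₁ * m₁) * (q₁ * m₂) * (q₁ * m₁₂) := by rw [hN]; push_cast; ring
  have hNq₁ : q₁ ∣ N := ⟨q₂ * m₁ * (q₁ * m₂) * (q₁ * m₁₂), by rw [hN]; ring⟩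
  have hNq₂ : q₂ ∣ N := ⟨(q₁ * m₁) * (q₁ * m₂) * (q₁ * m₁₂), by rw [hN]; ring⟩
  have hN₁ (h : γ₁.1 1 0 ≠ 0) : (q₁ : ℤ) * γ₁.1 1 0 ∣ N :=
    (mul_dvd_mul_left _ (hd₁ h)).trans ⟨q₂ * (q₁ * m₂) * (q₁ * m₁₂), by rw [hNz]; ring⟩
  have hN₂ (h : γ₂.1 1 0 ≠ 0) : (q₁ : ℤ) * γ₂.1 1 0 ∣ N :=
    (mul_dvd_mul_left _ (hd₂ h)).trans ⟨q₂ * (q₁ * m₁) * (q₁ * m₁₂), by rw [hNz]; ring⟩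
  have hN₁₂ (h : (γ₁ * γ₂).1 1 0 ≠ 0) : (q₁ : ℤ) * (γ₁ * γ₂).1 1 0 ∣ N :=
    (mul_dvd_mul_left _ (hd₁₂ h)).trans ⟨q₂ * (q₁ * m₁) * (q₁ * m₂), by rw [hNz]; ring⟩
  have hg := charWeight_periodic χ₁ χ₂ hNq₁ hNq₂
  have hg₀ : charWeight χ₁ χ₂ 0 = 0 := by
    have : Nontrivial (ZMod q₁) := by
      by_contra h
      rw [not_nontrivial_iff_subsingleton] at h
      exact hχ₁ (MulChar.ext fun x => by rw [Subsingleton.elim x 1]; simp)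
    simp only [charWeight, Prod.fst_zero, Int.cast_zero, MulChar.map_zero, map_zero, mul_zero]
  let f : ℤ × ℤ → ℤ × ℤ := fun P =>
    (γ₁.1 0 0 * P.1 + (-q₁ * γ₁.1 0 1) * P.2, (-(q₂ * l₁)) * P.1 + γ₁.1 1 1 * P.2)
  have hf_neg (P) : f (-P) = -f P := by
    ext <;> simp only [f, Prod.fst_neg, Prod.snd_neg] <;> ring
  have hf₁ : f (q₁, 0) = firstColumn q₁ γ₁ := by
    ext <;> simp only [f, firstColumn]
    · ring
    · rw [hl₁]; push_cast; ring
  have hf₂ : f (firstColumn q₁ γ₂) = firstColumn q₁ (γ₁ * γ₂) := by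
    ext <;> simp only [f, firstColumn, ha₁₂, hc₁₂]
    · ring
    · rw [hl₁]; push_cast; ring
  have hfg (P) : charWeight χ₁ χ₂ (f P) =
      χ₁ ((γ₁.1 1 1 : ℤ) : ZMod q₁) * (starRingEnd ℂ) (χ₂ ((γ₁.1 1 1 : ℤ) : ZMod q₂)) *
        charWeight χ₁ χ₂ P := by
    have hunit : χ₁ ((γ₁.1 1 1 : ℤ) : ZMod q₁) =
        (starRingEnd ℂ) (χ₁ ((γ₁.1 0 0 : ℤ) : ZMod q₁)) := by
      have hmod : ((γ₁.1 0 0 : ℤ) : ZMod q₁) * ((γ₁.1 1 1 : ℤ) : ZMod q₁) = 1 := by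
        have := congrArg (Int.cast (R := ZMod q₁)) hdet₁
        rw [hl₁] at this
        simpa using this
      have h₁ := congrArg χ₁ hmod
      have h₂ : χ₁⁻¹ ((γ₁.1 0 0 : ℤ) : ZMod q₁) * χ₁ ((γ₁.1 0 0 : ℤ) : ZMod q₁) = 1 := by
        rw [← MulChar.mul_apply, inv_mul_cancel, MulChar.one_apply (IsUnit.of_mul_eq_one _ hmod)]
      rw [map_mul, map_one] at h₁
      rw [starRingEnd_apply, MulChar.star_apply']
      calc χ₁ ((γ₁.1 1 1 : ℤ) : ZMod q₁)
          = (χ₁⁻¹ ((γ₁.1 0 0 : ℤ) : ZMod q₁) * χ₁ ((γ₁.1 0 0 : ℤ) : ZMod q₁)) *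
              χ₁ ((γ₁.1 1 1 : ℤ) : ZMod q₁) := by rw [h₂, one_mul]
        _ = χ₁⁻¹ ((γ₁.1 0 0 : ℤ) : ZMod q₁) := by rw [mul_assoc, h₁, mul_one]
    rw [hunit]
    simp only [charWeight, f]
    push_cast
    simp only [ZMod.natCast_self, neg_zero, zero_mul, add_zero, zero_add, map_mul]
    ring
  have huv : det₂ (q₁, 0) (firstColumn q₁ γ₁) = -(q₁ * γ₁.1 1 0) := by
    simp [det₂, firstColumn]
  have huw : det₂ (q₁, 0) (firstColumn q₁ γ₂) = -(q₁ * γ₂.1 1 0) := by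
    simp [det₂, firstColumn]
  have hvt : det₂ (firstColumn q₁ γ₁) (firstColumn q₁ (γ₁ * γ₂)) = -(q₁ * γ₂.1 1 0) := by
    simp only [det₂, firstColumn, ha₁₂, hc₁₂]
    linear_combination -q₁ * γ₂.1 1 0 * hdet₁
  have htu : det₂ (firstColumn q₁ (γ₁ * γ₂)) (q₁, 0) = q₁ * (γ₁ * γ₂).1 1 0 := by
    simp only [det₂, firstColumn]
    ring
  have hmap : dedekindPair N (charWeight χ₁ χ₂) (firstColumn q₁ γ₁) (firstColumn q₁ (γ₁ * γ₂)) =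
      χ₁ ((γ₁.1 1 1 : ℤ) : ZMod q₁) * (starRingEnd ℂ) (χ₂ ((γ₁.1 1 1 : ℤ) : ZMod q₂)) *
        dedekindPair N (charWeight χ₁ χ₂) (q₁, 0) (firstColumn q₁ γ₂) := by
    by_cases h : γ₂.1 1 0 = 0
    · rw [dedekindPair_of_det₂_eq_zero _ _ (hvt.trans (by simp [h])),
        dedekindPair_of_det₂_eq_zero _ _ (huw.trans (by simp [h])), mul_zero]
    · rw [← hf₁, ← hf₂]
      exact dedekindPair_map hg (a := γ₁.1 0 0) (b := -q₁ * γ₁.1 0 1) (c := -(q₂ * l₁))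
        (d := γ₁.1 1 1) (by rw [hl₁] at hdet₁; push_cast at hdet₁; linear_combination hdet₁)
        (fun P => rfl) hfg (by rw [huw, neg_dvd]; exact hN₂ h)
  have eq_or_eq_neg {γ : Matrix.SpecialLinearGroup (Fin 2) ℤ}
      (hdet : γ.1 0 0 * γ.1 1 1 - γ.1 0 1 * γ.1 1 0 = 1) (h : (q₁ : ℤ) * γ.1 1 0 = 0) :
      firstColumn q₁ γ = ((q₁ : ℤ), (0 : ℤ)) ∨ firstColumn q₁ γ = -((q₁ : ℤ), (0 : ℤ)) := by
    have hc := (mul_eq_zero.1 h).resolve_left (by exact_mod_cast hq₁.ne')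
    rw [hc, mul_zero, sub_zero] at hdet
    rcases Int.isUnit_iff.1 (IsUnit.of_mul_eq_one _ hdet) with ha | ha
    · left
      simp [firstColumn, ha, hc]
    · right
      simp [firstColumn, ha, hc]
  have hshift {γ : Matrix.SpecialLinearGroup (Fin 2) ℤ} (hγ : InGamma0 (q₁ * q₂) γ) (P) :
      charWeight χ₁ χ₂ (P + firstColumn q₁ γ) = charWeight χ₁ χ₂ P := by
    refine charWeight_add χ₁ χ₂ (Dvd.intro _ rfl) ?_ P
    exact (dvd_neg.2 ((Int.natCast_dvd_natCast.2 (Dvd.intro_left q₁ rfl)).trans hγ))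
  have hnegl {γ : Matrix.SpecialLinearGroup (Fin 2) ℤ}
      (hdet : γ.1 0 0 * γ.1 1 1 - γ.1 0 1 * γ.1 1 0 = 1) (hγ : InGamma0 (q₁ * q₂) γ) :
      IsNegligible N (charWeight χ₁ χ₂) (firstColumn q₁ γ) := by
    obtain ⟨l, hl⟩ := hγ
    have ha : IsUnit ((γ.1 0 0 : ℤ) : ZMod q₁) := by
      have := congrArg (Int.cast (R := ZMod q₁)) hdet
      rw [hl] at this
      exact IsUnit.of_mul_eq_one _ (by simpa using this)
    have := isNegligible_charWeight χ₂ hχ₁ hNq₁ hNq₂ ha (Dvd.intro l rfl)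
    rwa [show (q₁ : ℤ) * (q₂ * l) = γ.1 1 0 by rw [hl]; push_cast; ring] at this
  have hcocycle := dedekindPair_cocycle hg hg₀ (u := (q₁, 0))
    (charWeight_add χ₁ χ₂ dvd_rfl (dvd_zero _)) (hshift hγ₁) (hshift hγ₁₂)
    (by simpa using isNegligible_charWeight χ₂ hχ₁ hNq₁ hNq₂ (a := 1) (by simp) (dvd_zero _))
    (hnegl hdet₁ hγ₁) (hnegl hdet₁₂ hγ₁₂)
    (fun h => eq_or_eq_neg hdet₁ (neg_eq_zero.1 (huv.symm.trans h)))
    (fun h => by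
      rw [← hf₁, ← hf₂, ← hf_neg]
      rw [hvt, neg_eq_zero] at h
      exact (eq_or_eq_neg hdet₂ h).imp (congrArg f) (congrArg f))
    (fun h => (eq_or_eq_neg hdet₁₂ (htu.symm.trans h)).imp Eq.symm fun h => by rw [h, neg_neg])
    (fun h₁ h₂ h₁₂ => by
      rw [huv, neg_ne_zero] at h₁
      rw [hvt, neg_ne_zero] at h₂
      rw [htu] at h₁₂
      have k₁ := mul_dvd_mul_left (q₁ : ℤ) (hd₁ (right_ne_zero_of_mul h₁))
      have k₂ := mul_dvd_mul_left (q₁ : ℤ) (hd₂ (right_ne_zero_of_mul h₂))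
      have k₁₂ := mul_dvd_mul_left (q₁ : ℤ) (hd₁₂ (right_ne_zero_of_mul h₁₂))
      rw [huv, hvt, htu, hNz]
      refine Dvd.dvd.trans ⟨1, ?_⟩ (mul_dvd_mul (mul_dvd_mul (k₁.mul_left (q₂ : ℤ)) k₂) k₁₂)
      ring)
  rw [hmap, dedekindPair_swap N _ (q₁, 0), dedekindPair_firstColumn χ₁ χ₂ hγ₁ hN₁,
    dedekindPair_firstColumn χ₁ χ₂ hγ₂ hN₂, dedekindPair_firstColumn χ₁ χ₂ hγ₁₂ hN₁₂] at hcocycle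
  have hNc : (N : ℂ) ^ 2 ≠ 0 := pow_ne_zero 2 (by exact_mod_cast NeZero.ne N)
  apply mul_left_cancel₀ hNc
  linear_combination -hcocycle
end
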